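/- Let n ≥ 1, let m ∈ ½ℤ with m ≥ 0, and let λ = (λ_1,…,λ_n) be a partition or half-partition with λ_1 ≤ m. Then, viewing the even orthogonal character so^D_λ(x_1,…,x_n) as a rational function of t = x_1^{1/2} over the field ℚ(x_2^{1/2},…,x_n^{1/2}), the product x_1^m · so^D_λ(x_1,…,x_n) is a polynomial in t, and its value at t = 0 equals so^D_{(λ_2,…,λ_n)}(x_2,…,x_n) if λ_1 = m, and equals 0 if λ_1 < m. -/

import Mathlib

open Matrix BigOperators
open scoped Classical

noncomputable section

/-- The field `ℚ(t_1, …, t_n)` of rational functions in `n` indeterminates over `ℚ`. -/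
abbrev FF (n : ℕ) : Type := FractionRing (MvPolynomial (Fin n) ℚ)

/-- The `i`-th indeterminate, viewed as an element of `FF n`. -/
def gen (n : ℕ) (i : Fin n) : FF n :=
  algebraMap (MvPolynomial (Fin n) ℚ) (FF n) (MvPolynomial.X i)

variable {F : Type*} [Field F]

/-- Symplectic character `sp_λ(x_1, …, x_N)`, in "doubled" form: `z i` represents
`x_i^{1/2}` and `μ i` represents `2·λ_i` (so half-integer weights are allowed). -/
def spD {N : ℕ} (z : Fin N → F) (μ : Fin N → ℤ) : F :=
  Matrix.det (Matrix.of fun i j : Fin N =>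
      z j ^ (μ i + 2 * ((N : ℤ) - (i : ℕ))) - z j ^ (-(μ i + 2 * ((N : ℤ) - (i : ℕ))))) /
  Matrix.det (Matrix.of fun i j : Fin N =>
      z j ^ (2 * ((N : ℤ) - (i : ℕ))) - z j ^ (-(2 * ((N : ℤ) - (i : ℕ)))))

/-- Odd orthogonal character `so^B_λ(x_1, …, x_N)`, in "doubled" form: `z i` represents
`x_i^{1/2}` and `μ i` represents `2·λ_i`. -/
def soBD {N : ℕ} (z : Fin N → F) (μ : Fin N → ℤ) : F :=
  Matrix.det (Matrix.of fun i j : Fin N =>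
      z j ^ (μ i + 2 * ((N : ℤ) - (i : ℕ)) - 1) -
        z j ^ (-(μ i + 2 * ((N : ℤ) - (i : ℕ)) - 1))) /
  Matrix.det (Matrix.of fun i j : Fin N =>
      z j ^ (2 * ((N : ℤ) - (i : ℕ)) - 1) - z j ^ (-(2 * ((N : ℤ) - (i : ℕ)) - 1)))

/-- Even orthogonal character `so^D_λ(x_1, …, x_N)`, in "doubled" form: `z i` represents
`x_i^{1/2}` and `μ i` represents `2·λ_i`; the factor is `2` if `λ_N > 0` and `1` otherwise. -/
def soDD {N : ℕ} (z : Fin N → F) (μ : Fin N → ℤ) : F :=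
  (if h : 0 < N then (if 0 < μ ⟨N - 1, Nat.sub_lt h Nat.one_pos⟩ then (2 : F) else 1) else 1) *
  (Matrix.det (Matrix.of fun i j : Fin N =>
      z j ^ (μ i + 2 * ((N : ℤ) - 1 - (i : ℕ))) +
        z j ^ (-(μ i + 2 * ((N : ℤ) - 1 - (i : ℕ))))) /
   Matrix.det (Matrix.of fun i j : Fin N =>
      z j ^ (2 * ((N : ℤ) - 1 - (i : ℕ))) + z j ^ (-(2 * ((N : ℤ) - 1 - (i : ℕ))))))

/-- The matrix `Ā_λ` of the bialternant formula for the intermediate symplectic character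
`sp^{(k, N-k)}`, in "doubled" form: `z i` represents `x_i^{1/2}`, `μ i` represents `2·λ_i`. -/
def interMatD {N : ℕ} (k : ℕ) (z : Fin N → F) (μ : Fin N → ℤ) : Matrix (Fin N) (Fin N) F :=
  Matrix.of fun i j : Fin N =>
    if (j : ℕ) < k then
      z j ^ (μ i + 2 * ((k : ℤ) - (i : ℕ))) /
          ∏ l ∈ Finset.univ.filter (fun l : Fin N => k ≤ (l : ℕ)), (1 - (z j ^ 2)⁻¹ * z l ^ 2) -
        z j ^ (-(μ i + 2 * ((k : ℤ) - (i : ℕ)))) /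
          ∏ l ∈ Finset.univ.filter (fun l : Fin N => k ≤ (l : ℕ)), (1 - z j ^ 2 * z l ^ 2)
    else z j ^ (μ i + 2 * ((N : ℤ) - 1 - (i : ℕ)))

/-- Intermediate symplectic character `sp^{(k, N-k)}_λ(x_1, …, x_k | x_{k+1}, …, x_N)`, in
"doubled" form: `z i` represents `x_i^{1/2}` and `μ i` represents `2·λ_i`. -/
def spInterD {N : ℕ} (k : ℕ) (z : Fin N → F) (μ : Fin N → ℤ) : F :=
  (interMatD k z μ).det / (interMatD k z fun _ => 0).det

open Polynomial in
/-- A nonzero polynomial with at most `card ι` roots counted by degree, all of them simple and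
listed by `r`, divides every polynomial vanishing on `r`. -/
theorem Polynomial.dvd_of_eval_eq_zero_of_injective {K ι : Type*} [Field K] [Fintype ι]
    {r : ι → K} (hr : Function.Injective r) {p q : K[X]} (hq0 : q ≠ 0)
    (hdeg : q.natDegree ≤ Fintype.card ι) (hq : ∀ a, q.eval (r a) = 0)
    (hp : ∀ a, p.eval (r a) = 0) : q ∣ p := by
  have key : ∀ f : K[X], (∀ a, f.eval (r a) = 0) → (∏ a, (X - C (r a))) ∣ f := fun f hf =>
    Finset.prod_dvd_of_coprime
      (fun a _ b _ hab => pairwise_coprime_X_sub_C hr hab)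
      (fun a _ => dvd_iff_isRoot.mpr (hf a))
  obtain ⟨g, hg⟩ := key q hq
  have hmonic : (∏ a, (X - C (r a))).Monic := monic_prod_of_monic _ _ fun a _ => monic_X_sub_C _
  have hg0 : g ≠ 0 := by rintro rfl; simp_all
  have hgd : g.natDegree = 0 := by
    have h := hmonic.natDegree_mul' hg0
    rw [← hg, natDegree_prod_of_monic _ _ fun a _ => monic_X_sub_C _] at h
    simp only [natDegree_X_sub_C, Finset.sum_const, Finset.card_univ, smul_eq_mul, mul_one] at h
    omega
  have hunit : IsUnit g := isUnit_iff_degree_eq_zero.mpr <| by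
    rw [degree_eq_natDegree hg0, hgd]; rfl
  rw [hg]
  exact hunit.mul_right_dvd.mpr (key p hp)

/-- The matrix with entries `w_j ^ e_i + w_j ^ (-e_i)`. -/
def symmPowMatrix {N : ℕ} (w : Fin N → F) (e : Fin N → ℕ) : Matrix (Fin N) (Fin N) F :=
  Matrix.of fun i j => w j ^ (e i : ℤ) + w j ^ (-(e i : ℤ))

/-- The points `± z_j ^ (± 1)`. -/
def signedNode {k : ℕ} (z : Fin k → F) (a : Fin k × ℤˣ × ℤˣ) : F :=
  ((a.2.1 : ℤ) : F) * z a.1 ^ (a.2.2 : ℤ)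

theorem card_signedNode_index (k : ℕ) : Fintype.card (Fin k × ℤˣ × ℤˣ) = 4 * k := by
  simp [Fintype.card_prod]; ring

theorem signedNode_zpow_add {k : ℕ} (z : Fin k → F) (a : Fin k × ℤˣ × ℤˣ) (e : ℕ) :
    signedNode z a ^ (e : ℤ) + signedNode z a ^ (-(e : ℤ)) =
      ((a.2.1 : ℤ) : F) ^ e * (z a.1 ^ (e : ℤ) + z a.1 ^ (-(e : ℤ))) := by
  obtain ⟨j, s, u⟩ := a
  have hs : (((s : ℤ) : F))⁻¹ = ((s : ℤ) : F) := by
    rcases Int.units_eq_one_or s with rfl | rfl <;> simp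
  rcases Int.units_eq_one_or u with rfl | rfl <;>
    simp [signedNode, mul_pow, ← inv_pow, hs] <;> ring

theorem signedNode_ne_zero {k : ℕ} {z : Fin k → F} (hz : ∀ j, z j ≠ 0)
    (a : Fin k × ℤˣ × ℤˣ) : signedNode z a ≠ 0 := by
  obtain ⟨j, s, u⟩ := a
  refine mul_ne_zero ?_ (zpow_ne_zero _ (hz j))
  rcases Int.units_eq_one_or s with rfl | rfl <;> simp

open Polynomial in
/-- The determinant of `symmPowMatrix` as a polynomial in its first variable, after clearing
denominators by the power `e 0`. -/
def firstVarPoly {k : ℕ} (z : Fin k → F) (e : Fin (k + 1) → ℕ) : F[X] :=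
  ∑ i : Fin (k + 1), C ((-1) ^ (i : ℕ) * (symmPowMatrix z (e ∘ i.succAbove)).det) *
    (X ^ (e 0 + e i) + X ^ (e 0 - e i))

theorem aeval_firstVarPoly {L : Type*} [Field L] [Algebra F L] {k : ℕ} (z : Fin k → F)
    {e : Fin (k + 1) → ℕ} (he : ∀ i, e i ≤ e 0) {w : Fin (k + 1) → L} (hw0 : w 0 ≠ 0)
    (hw : ∀ j, w (Fin.succ j) = algebraMap F L (z j)) :
    Polynomial.aeval (w 0) (firstVarPoly z e) = w 0 ^ e 0 * (symmPowMatrix w e).det := by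
  rw [Matrix.det_succ_column_zero, Finset.mul_sum, firstVarPoly, map_sum]
  refine Finset.sum_congr rfl fun i _ => ?_
  have hsub : (symmPowMatrix w e).submatrix i.succAbove Fin.succ =
      (algebraMap F L).mapMatrix (symmPowMatrix z (e ∘ i.succAbove)) := by
    ext a b
    simp [symmPowMatrix, hw]
  rw [hsub, ← RingHom.map_det]
  have hpow : w 0 ^ (e 0 + e i) + w 0 ^ (e 0 - e i) =
      w 0 ^ e 0 * (w 0 ^ (e i : ℤ) + w 0 ^ (-(e i : ℤ))) := by
    rw [mul_add, pow_add, zpow_natCast, _root_.zpow_neg, zpow_natCast, pow_sub₀ _ hw0 (he i)]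
  simp only [map_mul, map_add, map_pow, Polynomial.aeval_C, Polynomial.aeval_X, hpow,
    map_neg, map_one]
  simp only [symmPowMatrix, Matrix.of_apply]
  ring

theorem eval_firstVarPoly {k : ℕ} {e : Fin (k + 1) → ℕ} (he : ∀ i, e i ≤ e 0)
    {w : Fin (k + 1) → F} (hw0 : w 0 ≠ 0) :
    (firstVarPoly (w ∘ Fin.succ) e).eval (w 0) = w 0 ^ e 0 * (symmPowMatrix w e).det := by
  rw [← aeval_firstVarPoly (w ∘ Fin.succ) he hw0 fun _ => rfl, Polynomial.coe_aeval_eq_eval]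

theorem eval_firstVarPoly_signedNode {k : ℕ} {z : Fin k → F} (hz : ∀ j, z j ≠ 0)
    {e : Fin (k + 1) → ℕ} (he : ∀ i, e i ≤ e 0) (hpar : ∀ i, Even (e i) ↔ Even (e 0))
    (a : Fin k × ℤˣ × ℤˣ) : (firstVarPoly z e).eval (signedNode z a) = 0 := by
  have h := eval_firstVarPoly (w := (Fin.cons (signedNode z a) z : Fin (k + 1) → F)) he
    (by simpa using signedNode_ne_zero hz a)
  have hsign : ∀ i, ((a.2.1 : ℤ) : F) ^ e i = ((a.2.1 : ℤ) : F) ^ e 0 := by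
    intro i
    rcases Int.units_eq_one_or a.2.1 with hs | hs
    · simp [hs]
    · have := hpar i
      by_cases h0 : Even (e 0)
      · simp [hs, h0.neg_one_pow, (this.mpr h0).neg_one_pow]
      · have hi : ¬ Even (e i) := fun hi => h0 (this.mp hi)
        rw [Nat.not_even_iff_odd] at h0 hi
        simp [hs, h0.neg_one_pow, hi.neg_one_pow]
  have hdet : (symmPowMatrix (Fin.cons (signedNode z a) z : Fin (k + 1) → F) e).det = 0 := by
    have hcol : symmPowMatrix (Fin.cons (signedNode z a) z : Fin (k + 1) → F) e =
        (symmPowMatrix (Fin.cons (z a.1) z : Fin (k + 1) → F) e).updateCol 0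
          (((a.2.1 : ℤ) : F) ^ e 0 •
            fun i => symmPowMatrix (Fin.cons (z a.1) z : Fin (k + 1) → F) e i 0) := by
      ext i j
      refine Fin.cases ?_ (fun j => ?_) j
      · simp only [symmPowMatrix, Matrix.of_apply, Matrix.updateCol_self, Fin.cons_zero,
          Pi.smul_apply, smul_eq_mul, signedNode_zpow_add, hsign]
      · simp [symmPowMatrix]
    rw [hcol, Matrix.det_updateCol_smul]
    refine mul_eq_zero_of_right _
      (Matrix.det_zero_of_column_eq (Fin.succ_ne_zero a.1).symm fun i => ?_)
    rw [Matrix.updateCol_self, Matrix.updateCol_ne (Fin.succ_ne_zero a.1)]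
    simp [symmPowMatrix]
  rw [hdet, mul_zero] at h
  simpa using h

theorem eval_zero_firstVarPoly {k : ℕ} (z : Fin k → F) {e : Fin (k + 1) → ℕ}
    (he : StrictAnti e) :
    (firstVarPoly z e).eval 0 =
      (if e 0 = 0 then 2 else 1) * (symmPowMatrix z (e ∘ Fin.succ)).det := by
  rw [firstVarPoly, Polynomial.eval_finsetSum, Finset.sum_eq_single 0]
  · rcases Nat.eq_zero_or_pos (e 0) with h | h
    · simp [h, Function.comp_def]; ring
    · simp [h.ne', Function.comp_def]
  · intro i _ hi
    have h := he (Fin.pos_of_ne_zero hi)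
    simp [(Nat.zero_le _ |>.trans_lt h).ne', (Nat.sub_pos_of_lt h).ne']
  · simp

theorem natDegree_firstVarPoly_le {k : ℕ} (z : Fin k → F) {e : Fin (k + 1) → ℕ}
    (he : ∀ i, e i ≤ e 0) : (firstVarPoly z e).natDegree ≤ 2 * e 0 := by
  refine Polynomial.natDegree_sum_le_of_forall_le _ _ fun i _ => ?_
  have h := he i
  refine (Polynomial.natDegree_C_mul_le _ _).trans (Polynomial.natDegree_add_le_of_degree_le ?_ ?_)
  · rw [Polynomial.natDegree_X_pow]; omega
  · rw [Polynomial.natDegree_X_pow]; omega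

/-- The doubled exponents of the denominator of the even orthogonal characters. -/
def evenExponent (N : ℕ) (i : Fin N) : ℕ := 2 * (N - 1 - i)

theorem evenExponent_comp_succ (k : ℕ) :
    evenExponent (k + 1) ∘ Fin.succ = evenExponent k := by
  ext i
  simp only [evenExponent, Function.comp_apply, Fin.val_succ]
  omega

theorem strictAnti_evenExponent (N : ℕ) : StrictAnti (evenExponent N) := by
  intro i j hij
  have := j.isLt
  simp only [evenExponent, Fin.lt_def] at *
  omega

theorem even_evenExponent (N : ℕ) (i : Fin N) : Even (evenExponent N i) := even_two_mul _

theorem det_symmPowMatrix_evenExponent_ne_zero (h2 : (2 : F) ≠ 0) {N : ℕ} {w : Fin N → F}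
    (hw0 : ∀ j, w j ≠ 0) (hw : Function.Injective (signedNode w)) :
    (symmPowMatrix w (evenExponent N)).det ≠ 0 := by
  induction N with
  | zero => simp
  | succ k ih =>
    intro hdet
    have he := strictAnti_evenExponent (k + 1)
    have hle : ∀ i, evenExponent (k + 1) i ≤ evenExponent (k + 1) 0 := fun i =>
      he.antitone (Fin.zero_le i)
    have hnode : ∀ a : Fin k × ℤˣ × ℤˣ,
        signedNode (w ∘ Fin.succ) a = signedNode w (a.1.succ, a.2) := fun _ => rfl
    have hinj : Function.Injective (signedNode (w ∘ Fin.succ)) := by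
      rintro ⟨i, a⟩ ⟨j, b⟩ h
      have h' := Prod.ext_iff.mp (hw ((hnode _).symm.trans (h.trans (hnode _))))
      exact Prod.ext (Fin.succ_injective _ h'.1) h'.2
    have hC := ih (fun j => hw0 j.succ) hinj
    have hzero : firstVarPoly (w ∘ Fin.succ) (evenExponent (k + 1)) = 0 := by
      have hnotMem : w 0 ∉ Finset.univ.image (signedNode (w ∘ Fin.succ)) := by
        simp only [Finset.mem_image, Finset.mem_univ, true_and, not_exists]
        intro a ha
        have h0 : signedNode w (0, 1, 1) = w 0 := by simp [signedNode]
        rw [hnode, ← h0] at ha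
        exact Fin.succ_ne_zero _ (Prod.ext_iff.mp (hw ha)).1
      refine Polynomial.eq_zero_of_natDegree_lt_card_of_eval_eq_zero' _
        (insert (w 0) (Finset.univ.image (signedNode (w ∘ Fin.succ)))) ?_ ?_
      · intro x hx
        rcases Finset.mem_insert.mp hx with rfl | hx
        · rw [eval_firstVarPoly hle (hw0 0), hdet, mul_zero]
        · obtain ⟨a, -, rfl⟩ := Finset.mem_image.mp hx
          exact eval_firstVarPoly_signedNode (fun j => hw0 j.succ) hle
            (fun i => by simp [even_evenExponent]) a
      · rw [Finset.card_insert_of_notMem hnotMem, Finset.card_image_of_injective _ hinj,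
          Finset.card_univ, card_signedNode_index]
        refine (natDegree_firstVarPoly_le _ hle).trans_lt ?_
        simp only [evenExponent, Fin.val_zero]
        omega
    have h := eval_zero_firstVarPoly (w ∘ Fin.succ) he
    rw [hzero, Polynomial.eval_zero, evenExponent_comp_succ] at h
    refine mul_ne_zero ?_ hC h.symm
    split_ifs
    · exact h2
    · exact one_ne_zero

theorem firstVarPoly_evenExponent_dvd (h2 : (2 : F) ≠ 0) {k : ℕ} {z : Fin k → F}
    (hz : ∀ j, z j ≠ 0) (hinj : Function.Injective (signedNode z)) {e : Fin (k + 1) → ℕ}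
    (he : ∀ i, e i ≤ e 0) (hpar : ∀ i, Even (e i) ↔ Even (e 0)) :
    firstVarPoly z (evenExponent (k + 1)) ∣ firstVarPoly z e := by
  have hanti := strictAnti_evenExponent (k + 1)
  have hle : ∀ i, evenExponent (k + 1) i ≤ evenExponent (k + 1) 0 := fun i =>
    hanti.antitone (Fin.zero_le i)
  refine Polynomial.dvd_of_eval_eq_zero_of_injective hinj ?_ ?_
    (eval_firstVarPoly_signedNode hz hle fun i => by simp [even_evenExponent])
    (eval_firstVarPoly_signedNode hz he hpar)
  · intro hzero
    have h := eval_zero_firstVarPoly z hanti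
    rw [hzero, Polynomial.eval_zero, evenExponent_comp_succ] at h
    refine mul_ne_zero ?_ (det_symmPowMatrix_evenExponent_ne_zero h2 hz hinj) h.symm
    split_ifs
    · exact h2
    · exact one_ne_zero
  · rw [card_signedNode_index]
    refine (natDegree_firstVarPoly_le _ hle).trans ?_
    simp only [evenExponent, Fin.val_zero]
    omega

theorem gen_ne_zero (k : ℕ) (i : Fin k) : gen k i ≠ 0 := by
  rw [gen, Ne, FaithfulSMul.algebraMap_eq_zero_iff]
  exact MvPolynomial.X_ne_zero i

theorem signedNode_gen_injective (k : ℕ) : Function.Injective (signedNode (gen k)) := by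
  have hinj := IsFractionRing.injective (MvPolynomial (Fin k) ℚ) (FF k)
  have hmul : ∀ (i j : Fin k) (s : ℤ), s = 1 ∨ s = -1 → gen k i * gen k j ≠ (s : FF k) := by
    intro i j s hs h
    have h' : (MvPolynomial.X i * MvPolynomial.X j : MvPolynomial (Fin k) ℚ) = (s : ℤ) :=
      hinj (by simpa [gen] using h)
    have h'' := congrArg (MvPolynomial.eval fun _ => (2 : ℚ)) h'
    rcases hs with rfl | rfl <;> norm_num at h''
  have heq : ∀ (i j : Fin k) (s : ℤ), s = 1 ∨ s = -1 → gen k i = (s : FF k) * gen k j →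
      i = j ∧ s = 1 := by
    intro i j s hs h
    have h' : (MvPolynomial.X i : MvPolynomial (Fin k) ℚ) =
        (s : MvPolynomial (Fin k) ℚ) * MvPolynomial.X j :=
      hinj (by simpa [gen] using h)
    have h'' := congrArg (MvPolynomial.eval fun l => if l = i then (2 : ℚ) else 3) h'
    by_cases hij : j = i <;> rcases hs with rfl | rfl <;> simp [hij] at h'' ⊢ <;>
      norm_num at h''
  rintro ⟨i, s, u⟩ ⟨j, s', u'⟩ h
  have hi := gen_ne_zero k i
  have hj := gen_ne_zero k j
  have hs : ((s : ℤ) : FF k) * ((s : ℤ) : FF k) = 1 := by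
    rcases Int.units_eq_one_or s with rfl | rfl <;> simp
  have hss : ((s * s' : ℤˣ) : ℤ) = 1 ∨ ((s * s' : ℤˣ) : ℤ) = -1 := by
    rcases Int.units_eq_one_or (s * s') with h | h <;> simp [h]
  have hmain : gen k i ^ (u : ℤ) = ((s * s' : ℤˣ) : ℤ) * gen k j ^ (u' : ℤ) := by
    simp only [signedNode] at h
    push_cast
    linear_combination ((s : ℤ) : FF k) * h - gen k i ^ (u : ℤ) * hs
  have hsq : (((s * s' : ℤˣ) : ℤ) : FF k) * (((s * s' : ℤˣ) : ℤ) : FF k) = 1 := by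
    rcases hss with h | h <;> rw [h] <;> simp
  have hconcl : ∀ {i j : Fin k}, gen k i = ((s * s' : ℤˣ) : ℤ) * gen k j → i = j ∧ s = s' := by
    intro i j h
    obtain ⟨hij, h1⟩ := heq i j _ hss h
    refine ⟨hij, ?_⟩
    rcases Int.units_eq_one_or s with rfl | rfl <;>
      rcases Int.units_eq_one_or s' with rfl | rfl <;> simp_all
  rcases Int.units_eq_one_or u with rfl | rfl <;> rcases Int.units_eq_one_or u' with rfl | rfl
  · obtain ⟨rfl, rfl⟩ := hconcl (by simpa using hmain)
    rfl
  · refine absurd ?_ (hmul i j _ hss)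
    simp only [Units.val_one, Units.val_neg, zpow_one, _root_.zpow_neg] at hmain
    rw [hmain, mul_assoc, inv_mul_cancel₀ hj, mul_one]
  · refine absurd ?_ (hmul i j _ hss)
    simp only [Units.val_one, Units.val_neg, zpow_one, _root_.zpow_neg] at hmain
    field_simp at hmain
    linear_combination -((s * s' : ℤˣ) : ℤ) * hmain - gen k i * gen k j * hsq
  · have h' : gen k j = ((s * s' : ℤˣ) : ℤ) * gen k i := by
      simp only [Units.val_one, Units.val_neg, zpow_one, _root_.zpow_neg] at hmain
      field_simp at hmain
      linear_combination hmain
    obtain ⟨rfl, rfl⟩ := hconcl h'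
    rfl

theorem soDD_eq_symmPowMatrix_det_div {N : ℕ} (z : Fin N → F) {μ : Fin N → ℤ} {e : Fin N → ℕ}
    (he : ∀ i, (e i : ℤ) = μ i + evenExponent N i) :
    soDD z μ =
      (if h : 0 < N then (if 0 < μ ⟨N - 1, Nat.sub_lt h Nat.one_pos⟩ then (2 : F) else 1) else 1) *
        ((symmPowMatrix z e).det / (symmPowMatrix z (evenExponent N)).det) := by
  have hexp : ∀ i : Fin N, (evenExponent N i : ℤ) = 2 * ((N : ℤ) - 1 - (i : ℕ)) := by
    intro i
    have := i.isLt
    simp only [evenExponent]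
    omega
  simp only [soDD, symmPowMatrix, he, hexp]

/-- **Lemma (reduction lemma, part (2), even orthogonal case).**  Let `n ≥ 1`, `m = m2/2` a
nonnegative half-integer, and `λ = μ/2` a partition or half-partition (all parts integers, or
all parts in `ℕ + 1/2`) with `λ_1 ≤ m`.  Viewing the even orthogonal character
`so^D_λ(x_1, …, x_n)` as a rational function of `t = x_1^{1/2}` over the field
`ℚ(x_2^{1/2}, …, x_n^{1/2})`, the product `x_1^m · so^D_λ` is a polynomial in `t`, whose value
at `t = 0` is `so^D_{(λ_2,…,λ_n)}(x_2, …, x_n)` if `λ_1 = m` and is `0` if `λ_1 < m`.  Here the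
base field is `FF (n-1)` (with `gen (n-1) i` playing the role of `x_{i+2}^{1/2}`), `RatFunc.X`
plays the role of `t = x_1^{1/2}` (so `x_1^m = t^{m2}`), and all weights are doubled. -/
theorem soD_mul_pow_eq_polynomial_and_eval_zero (n : ℕ) (hn : 0 < n) (m2 : ℤ) (hm : 0 ≤ m2)
    (μ : Fin n → ℤ) (hanti : Antitone μ) (hpos : ∀ i, 0 ≤ μ i)
    (hpar : (∀ i, Even (μ i)) ∨ (∀ i, Odd (μ i))) (hlam : μ ⟨0, hn⟩ ≤ m2) :
    ∃ p : Polynomial (FF (n - 1)),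
      (RatFunc.X : RatFunc (FF (n - 1))) ^ m2 *
          soDD
            (fun j : Fin n =>
              if h : (j : ℕ) = 0 then RatFunc.X
              else
                algebraMap (FF (n - 1)) (RatFunc (FF (n - 1)))
                  (gen (n - 1) ⟨(j : ℕ) - 1, by have := j.isLt; omega⟩))
            μ =
        algebraMap (Polynomial (FF (n - 1))) (RatFunc (FF (n - 1))) p ∧
      p.eval 0 =
        if μ ⟨0, hn⟩ = m2 then
          soDD (gen (n - 1))
            (fun i : Fin (n - 1) => μ ⟨(i : ℕ) + 1, by have := i.isLt; omega⟩)
        else 0 := by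
  obtain ⟨k, rfl⟩ : ∃ k, n = k + 1 := ⟨n - 1, by omega⟩
  change ∃ p : Polynomial (FF k), (RatFunc.X : RatFunc (FF k)) ^ m2 * soDD (fun j : Fin (k + 1) =>
    if h : (j : ℕ) = 0 then (RatFunc.X : RatFunc (FF k))
    else algebraMap (FF k) (RatFunc (FF k)) (gen k ⟨(j : ℕ) - 1, by have := j.isLt; omega⟩)) μ =
      algebraMap (Polynomial (FF k)) (RatFunc (FF k)) p ∧
    p.eval 0 = if μ 0 = m2 then soDD (gen k) (μ ∘ Fin.succ) else 0
  set w : Fin (k + 1) → RatFunc (FF k) := fun j =>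
    if h : (j : ℕ) = 0 then RatFunc.X
    else algebraMap (FF k) (RatFunc (FF k)) (gen k ⟨(j : ℕ) - 1, by have := j.isLt; omega⟩)
    with hwdef
  have hw0 : w 0 = RatFunc.X := by simp [hwdef]
  have hw0' : w 0 ≠ 0 := hw0 ▸ RatFunc.X_ne_zero
  have hws : ∀ j : Fin k, w j.succ = algebraMap (FF k) (RatFunc (FF k)) (gen k j) := by
    intro j
    simp [hwdef]
  obtain ⟨ν, rfl⟩ : ∃ ν : Fin (k + 1) → ℕ, μ = fun i => (ν i : ℤ) :=
    ⟨fun i => (μ i).toNat, funext fun i => by simp [hpos i]⟩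
  obtain ⟨d, rfl⟩ : ∃ d : ℕ, m2 = ν 0 + d := ⟨(m2 - ν 0).toNat, by
    have : (ν 0 : ℤ) ≤ m2 := hlam
    omega⟩
  have hδ := strictAnti_evenExponent (k + 1)
  set e : Fin (k + 1) → ℕ := fun i => ν i + evenExponent (k + 1) i with hedef
  have he : StrictAnti e := fun i j hij =>
    add_lt_add_of_le_of_lt (Int.ofNat_le.mp (hanti hij.le)) (hδ hij)
  have hpar' : ∀ i, Even (e i) ↔ Even (e 0) := by
    intro i
    simp only [hedef, Nat.even_add, even_evenExponent, iff_true]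
    rcases hpar with h | h
    · exact iff_of_true ((Int.even_coe_nat _).mp (h i)) ((Int.even_coe_nat _).mp (h 0))
    · have h' : ∀ i, Odd (ν i) := fun i => (Int.odd_coe_nat _).mp (h i)
      exact iff_of_false (Nat.not_even_iff_odd.mpr (h' i)) (Nat.not_even_iff_odd.mpr (h' 0))
  have hle : ∀ i, e i ≤ e 0 := fun i => he.antitone (Fin.zero_le i)
  have hδle : ∀ i, evenExponent (k + 1) i ≤ evenExponent (k + 1) 0 := fun i =>
    hδ.antitone (Fin.zero_le i)
  have hden := det_symmPowMatrix_evenExponent_ne_zero (two_ne_zero (α := FF k))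
    (gen_ne_zero k) (signedNode_gen_injective k)
  obtain ⟨R, hR⟩ := firstVarPoly_evenExponent_dvd (two_ne_zero (α := FF k)) (gen_ne_zero k)
    (signedNode_gen_injective k) hle hpar'
  have haeval : ∀ f : Polynomial (FF k), Polynomial.aeval (w 0) f =
      algebraMap (Polynomial (FF k)) (RatFunc (FF k)) f := by
    intro f
    rw [hw0, ← RatFunc.algebraMap_X, Polynomial.aeval_algebraMap_apply, Polynomial.aeval_X_left,
      AlgHom.id_apply]
  have hnumL := aeval_firstVarPoly (gen k) hle hw0' hws
  have hdenL := aeval_firstVarPoly (gen k) hδle hw0' hws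
  have hnum0 := eval_zero_firstVarPoly (gen k) he
  have hden0 := eval_zero_firstVarPoly (gen k) hδ
  rw [evenExponent_comp_succ] at hden0
  rw [haeval] at hnumL hdenL
  have hdenpoly : firstVarPoly (gen k) (evenExponent (k + 1)) ≠ 0 := by
    intro hzero
    rw [hzero, Polynomial.eval_zero] at hden0
    refine mul_ne_zero ?_ hden hden0.symm
    split_ifs
    · exact two_ne_zero
    · exact one_ne_zero
  have hdenL0 : (symmPowMatrix w (evenExponent (k + 1))).det ≠ 0 := by
    intro hzero
    rw [hzero, mul_zero] at hdenL
    exact RatFunc.algebraMap_ne_zero hdenpoly hdenL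
  set c : ℕ := if 0 < ν (Fin.last k) then 2 else 1 with hc
  have hsoL : soDD w (fun i => (ν i : ℤ)) = c *
      ((symmPowMatrix w e).det / (symmPowMatrix w (evenExponent (k + 1))).det) := by
    rw [soDD_eq_symmPowMatrix_det_div w (e := e) fun i => by simp [hedef]]
    congr 1
    rw [dif_pos k.succ_pos, hc, Nat.cast_ite]
    simp [Fin.last]
  refine ⟨Polynomial.C (c : FF k) * Polynomial.X ^ d * R, ?_, ?_⟩
  · rw [hR, map_mul, hdenL] at hnumL
    have hquot : w 0 ^ ν 0 *
        ((symmPowMatrix w e).det / (symmPowMatrix w (evenExponent (k + 1))).det) =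
        algebraMap (Polynomial (FF k)) (RatFunc (FF k)) R := by
      rw [mul_div_assoc', div_eq_iff hdenL0]
      refine mul_left_cancel₀ (pow_ne_zero (evenExponent (k + 1) 0) hw0') ?_
      rw [hedef, pow_add] at hnumL
      linear_combination -hnumL
    rw [hsoL, map_mul, map_mul, ← hquot, ← hw0, zpow_add₀ hw0', zpow_natCast, zpow_natCast,
      map_pow, RatFunc.algebraMap_X, ← hw0]
    simp only [map_natCast]
    ring
  · rw [hR, Polynomial.eval_mul, hden0] at hnum0
    rcases Nat.eq_zero_or_pos d with rfl | hd
    · have hcond : ((ν 0 : ℕ) : ℤ) = ν 0 + (0 : ℕ) := by simp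
      have hsucc : ∀ i : Fin k, evenExponent (k + 1) i.succ = evenExponent k i :=
        congrFun (evenExponent_comp_succ k)
      rw [if_pos hcond, soDD_eq_symmPowMatrix_det_div (gen k) (e := e ∘ Fin.succ) fun i => by
        simp [hedef, hsucc], mul_div_assoc', eq_div_iff hden]
      simp only [pow_zero, mul_one, Polynomial.eval_mul, Polynomial.eval_C]
      cases k with
      | zero =>
        have h0 : evenExponent (0 + 1) 0 = 0 := rfl
        have hlast : Fin.last 0 = 0 := rfl
        simp only [Matrix.det_fin_zero, hedef, h0, hc, hlast] at hnum0 ⊢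
        rcases Nat.eq_zero_or_pos (ν 0) with hν | hν
        · simp [hν] at hnum0 ⊢
          exact hnum0
        · simp [hν, hν.ne'] at hnum0 ⊢
          linear_combination hnum0
      | succ k =>
        have hδ0 : evenExponent (k + 1 + 1) 0 ≠ 0 := by simp [evenExponent]
        have he0 : e 0 ≠ 0 := by simp [hedef, hδ0]
        rw [if_neg hδ0, if_neg he0, one_mul, one_mul] at hnum0
        rw [dif_pos k.succ_pos, mul_assoc, mul_comm (R.eval 0), hnum0, hc, Nat.cast_ite]
        simp [Fin.last]
    · have hcond : ¬ ((ν 0 : ℕ) : ℤ) = ν 0 + (d : ℕ) := by omega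
      rw [if_neg hcond]
      simp [hd.ne']
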